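/- The number of permutations of {1,...,n} with positive up-down sequence (for every j ≤ n, the number of ascents at positions < j is at most the number of descents at positions < j) equals [(n-1)!!]² if n is even, and n!!·(n-2)!! if n is odd. -/

import Mathlib

/-- The number of ascents of `σ` at (1-indexed) positions `< j`: indices `i < j` with
`σ i < σ (i+1)`. Here the step at 1-indexed position `i+1` is encoded by `i : Fin (n-1)`. -/
def ascentsBelow (n : ℕ) (σ : Equiv.Perm (Fin n)) (j : ℕ) : ℕ :=
  (Finset.univ.filter (fun i : Fin (n - 1) => i.1 + 1 < j ∧
    σ ⟨i.1, by have := i.isLt; omega⟩ < σ ⟨i.1 + 1, by have := i.isLt; omega⟩)).card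

/-- The number of descents of `σ` at (1-indexed) positions `< j`. -/
def descentsBelow (n : ℕ) (σ : Equiv.Perm (Fin n)) (j : ℕ) : ℕ :=
  (Finset.univ.filter (fun i : Fin (n - 1) => i.1 + 1 < j ∧
    σ ⟨i.1 + 1, by have := i.isLt; omega⟩ < σ ⟨i.1, by have := i.isLt; omega⟩)).card

theorem exists_first_argmin (g : ℕ → ℤ) {n : ℕ} (hn : 0 < n) :
    ∃ p < n, (∀ i < n, g p ≤ g i) ∧ ∀ i < p, g p < g i := by
  induction n, hn using Nat.le_induction with
  | base => exact ⟨0, by grind⟩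
  | succ n hn ih =>
    obtain ⟨p, hp, h1, h2⟩ := ih
    by_cases h : g n < g p
    · exact ⟨n, by grind⟩
    · exact ⟨p, by grind⟩

theorem exists_last_argmin (g : ℕ → ℤ) {n : ℕ} (hn : 0 < n) :
    ∃ p < n, (∀ i < n, g p ≤ g i) ∧ ∀ i < n, p < i → g p < g i := by
  induction n, hn using Nat.le_induction with
  | base => exact ⟨0, by grind⟩
  | succ n hn ih =>
    obtain ⟨p, hp, h1, h2⟩ := ih
    by_cases h : g n ≤ g p
    · exact ⟨n, by grind⟩
    · exact ⟨p, by grind⟩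

/-- The positions at which a `±1` path can be cut so that each half stays above its end at the
cut are just before the first minimum and just after the last one. -/
theorem sum_neg_one_pow_cuts {n : ℕ} (hn : 0 < n) (g : ℕ → ℤ)
    (hg : ∀ i, i + 1 < n → g (i + 1) = g i + 1 ∨ g (i + 1) = g i - 1) :
    ∑ k ∈ (Finset.range (n + 1)).filter
      (fun k ↦ (∀ i < k, g (k - 1) ≤ g i) ∧ ∀ i < n, k ≤ i → g k ≤ g i), (-1 : ℤ) ^ k = 0 := by
  obtain ⟨p, hp, hp1, hp2⟩ := exists_first_argmin g hn
  obtain ⟨q, hq, hq1, hq2⟩ := exists_last_argmin g hn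
  have parity : ∀ i < n, (g i - g 0 - i) % 2 = 0 := by
    intro i
    induction i with
    | zero => simp
    | succ i ih => intro hi; have := hg i hi; have := ih (by omega); push_cast; omega
  have hgpq : g p = g q := le_antisymm (hp1 q hq) (hq1 p hp)
  have hpq : p ≤ q := by by_contra h; have := hq2 p hp (by omega); omega
  have hmod : p % 2 = q % 2 := by have := parity p hp; have := parity q hq; omega
  have hset : (Finset.range (n + 1)).filter
      (fun k ↦ (∀ i < k, g (k - 1) ≤ g i) ∧ ∀ i < n, k ≤ i → g k ≤ g i) = {p, q + 1} := by
    ext k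
    simp only [Finset.mem_filter, Finset.mem_range, Finset.mem_insert, Finset.mem_singleton]
    constructor
    · rintro ⟨hk, hl, hr⟩
      rcases Nat.eq_zero_or_pos k with rfl | hk0
      · left
        by_contra hne
        have := hp2 0 (by omega)
        have := hr p hp (by omega)
        omega
      rcases Nat.lt_or_ge k n with hkn | hkn
      · rcases hg (k - 1) (by omega) with h | h <;> rw [Nat.sub_add_cancel hk0] at h
        · right
          by_contra hne
          rcases lt_or_gt_of_ne hne with hlt | hlt
          · have := hr q hq (by omega)
            have := hq1 (k - 1) (by omega)
            omega
          · have := hq2 (k - 1) (by omega) (by omega)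
            have := hl q (by omega)
            omega
        · left
          by_contra hne
          rcases lt_or_gt_of_ne hne with hlt | hlt
          · have := hp2 k hlt
            have := hr p hp (by omega)
            omega
          · have := hl p (by omega)
            have := hp1 k hkn
            omega
      · right
        by_contra hne
        have := hl q (by omega)
        have := hq2 (k - 1) (by omega) (by omega)
        omega
    · rintro (rfl | rfl)
      · refine ⟨by omega, fun i hi ↦ ?_, fun i hi _ ↦ hp1 i hi⟩
        have h1 := hp2 i hi
        have h2 := hp2 (k - 1) (by omega)
        have h3 := hg (k - 1) (by omega)
        rw [Nat.sub_add_cancel (by omega)] at h3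
        omega
      · refine ⟨by omega, fun i hi ↦ hq1 i (by omega), fun i hi hqi ↦ ?_⟩
        have h1 := hq2 i hi (by omega)
        have h3 := hg q (by omega)
        have := hq2 (q + 1) (by omega) (by omega)
        omega
  rw [hset, Finset.sum_pair (by omega), pow_succ, neg_one_pow_eq_pow_mod_two p, hmod,
    ← neg_one_pow_eq_pow_mod_two q]
  ring

section Orderings

open Finset

/-- The lists enumerating a finite set of naturals without repetition. -/
def orderings (S : Finset ℕ) : Finset (List ℕ) :=
  ⟨S.val.lists, Multiset.lists_nodup_finset S⟩

theorem mem_orderings {S : Finset ℕ} {l : List ℕ} :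
    l ∈ orderings S ↔ l.Nodup ∧ l.toFinset = S := by
  change l ∈ S.val.lists ↔ _
  rw [Multiset.mem_lists_iff]
  constructor
  · intro h
    have hl : l.Nodup := by have := S.nodup; rw [h] at this; exact this
    refine ⟨hl, ?_⟩
    ext x
    rw [List.mem_toFinset, mem_def, h]
    rfl
  · rintro ⟨hl, rfl⟩
    rw [List.toFinset_val, hl.dedup]
    rfl

theorem length_of_mem_orderings {S : Finset ℕ} {l : List ℕ} (h : l ∈ orderings S) :
    l.length = #S := by
  obtain ⟨h1, rfl⟩ := mem_orderings.1 h
  rw [List.toFinset_card_of_nodup h1]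

/-- Cutting orderings of `S` after `k` entries. -/
theorem card_orderings_filter_take_drop (S : Finset ℕ) (k : ℕ) (P Q : List ℕ → Prop)
    [DecidablePred P] [DecidablePred Q] (hk : k ≤ #S) :
    #{w ∈ orderings S | P (w.take k) ∧ Q (w.drop k)} =
      ∑ T ∈ S.powersetCard k, #{l ∈ orderings T | P l} * #{l ∈ orderings (S \ T) | Q l} := by
  simp_rw [← card_product]
  rw [← card_sigma]
  refine card_nbij' (fun w ↦ ⟨(w.take k).toFinset, (w.take k, w.drop k)⟩)
    (fun x ↦ x.2.1 ++ x.2.2) ?_ ?_ ?_ ?_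
  · intro w hw
    simp only [coe_filter, Set.mem_ofPred_eq] at hw
    obtain ⟨hw, hP, hQ⟩ := hw
    have hlen := length_of_mem_orderings hw
    obtain ⟨hnd, rfl⟩ := mem_orderings.1 hw
    have hnd1 : (w.take k).Nodup := hnd.sublist (List.take_sublist k w)
    have hnd2 : (w.drop k).Nodup := hnd.sublist (List.drop_sublist k w)
    have hdisj : ∀ x ∈ w.take k, x ∉ w.drop k := fun x h1 h2 ↦
      (List.disjoint_take_drop hnd le_rfl) h1 h2
    have hor : ∀ x, x ∈ w ↔ x ∈ w.take k ∨ x ∈ w.drop k := fun x ↦ by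
      rw [← List.mem_append, List.take_append_drop]
    have hsd : (w.drop k).toFinset = w.toFinset \ (w.take k).toFinset := by
      ext x
      have := hdisj x
      simp only [mem_sdiff, List.mem_toFinset, hor]
      tauto
    simp only [coe_sigma, Set.mem_sigma_iff, mem_coe, mem_powersetCard, mem_product, mem_filter,
      mem_orderings, and_true]
    refine ⟨⟨fun x hx ↦ ?_, ?_⟩, ⟨hnd1, hP⟩, ⟨⟨hnd2, hsd⟩, hQ⟩⟩
    · rw [List.mem_toFinset] at hx ⊢
      rw [hor]
      exact Or.inl hx
    · rw [List.toFinset_card_of_nodup hnd1, List.length_take]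
      omega
  · rintro ⟨T, σ, τ⟩ h
    simp only [coe_sigma, Set.mem_sigma_iff, mem_coe, mem_powersetCard, mem_product,
      mem_filter] at h
    obtain ⟨⟨hT, hTk⟩, ⟨hσ, hP⟩, ⟨hτ, hQ⟩⟩ := h
    have hlen : σ.length = k := by rw [length_of_mem_orderings hσ, hTk]
    simp only [coe_filter, Set.mem_ofPred_eq]
    refine ⟨?_, by rwa [List.take_left' hlen], by rwa [List.drop_left' hlen]⟩
    rw [mem_orderings] at hσ hτ ⊢
    refine ⟨List.nodup_append'.2 ⟨hσ.1, hτ.1, ?_⟩, ?_⟩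
    · rw [← List.disjoint_toFinset_iff_disjoint, hσ.2, hτ.2]
      exact disjoint_sdiff
    · rw [List.toFinset_append, hσ.2, hτ.2, union_sdiff_of_subset hT]
  · intro w _
    simp
  · rintro ⟨T, σ, τ⟩ h
    simp only [coe_sigma, Set.mem_sigma_iff, mem_coe, mem_powersetCard, mem_product,
      mem_filter] at h
    obtain ⟨⟨hT, hTk⟩, ⟨hσ, hP⟩, ⟨hτ, hQ⟩⟩ := h
    have hlen : σ.length = k := by rw [length_of_mem_orderings hσ, hTk]
    simp [List.take_left' hlen, List.drop_left' hlen, (mem_orderings.1 hσ).2]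

/-- The number of descents minus the number of ascents among the first `i` steps of `l`. -/
def height (l : List ℕ) (i : ℕ) : ℤ :=
  ∑ j ∈ range i, ((l.getD j 0 : ℤ) - l.getD (j + 1) 0).sign

/-- Every prefix of `l` has at most as many ascents as descents. -/
def NonnegPath (l : List ℕ) : Prop := ∀ i < l.length, 0 ≤ height l i

instance : DecidablePred NonnegPath := fun l ↦ by unfold NonnegPath; infer_instance

theorem height_succ (l : List ℕ) (i : ℕ) :
    height l (i + 1) = height l i + ((l.getD i 0 : ℤ) - l.getD (i + 1) 0).sign :=
  sum_range_succ _ _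

theorem height_zero (l : List ℕ) : height l 0 = 0 := rfl

theorem height_succ_of_nodup {l : List ℕ} (hl : l.Nodup) {i : ℕ} (hi : i + 1 < l.length) :
    height l (i + 1) = height l i + 1 ∨ height l (i + 1) = height l i - 1 := by
  rw [height_succ, List.getD_eq_getElem _ _ hi, List.getD_eq_getElem _ _ (by omega)]
  have : l[i] ≠ l[i + 1] := fun h ↦ by
    have := (hl.getElem_inj_iff).1 h
    omega
  rcases lt_or_gt_of_ne this with h | h
  · right
    rw [Int.sign_eq_neg_one_of_neg (by omega)]
    rfl
  · left
    rw [Int.sign_eq_one_of_pos (by omega)]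

theorem height_drop (l : List ℕ) (k i : ℕ) :
    height (l.drop k) i = height l (k + i) - height l k := by
  induction i with
  | zero => simp [height_zero]
  | succ i ih =>
    rw [height_succ, ih, ← add_assoc, height_succ]
    simp only [List.getD_eq_getElem?_getD, List.getElem?_drop, ← add_assoc]
    ring

theorem height_take (l : List ℕ) {k i : ℕ} (hi : i < k) : height (l.take k) i = height l i := by
  refine sum_congr rfl fun j hj ↦ ?_
  rw [mem_range] at hj
  simp only [List.getD_eq_getElem?_getD]
  rw [List.getElem?_take_of_lt (by omega), List.getElem?_take_of_lt (by omega)]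

theorem height_reverse (l : List ℕ) {i : ℕ} (hi : i < l.length) :
    height l.reverse i = height l (l.length - 1 - i) - height l (l.length - 1) := by
  induction i with
  | zero => simp [height_zero]
  | succ i ih =>
    rw [height_succ, ih (by omega)]
    have h : l.length - 1 - i = l.length - 1 - (i + 1) + 1 := by omega
    simp only [List.getD_eq_getElem?_getD]
    rw [List.getElem?_reverse hi, List.getElem?_reverse (by omega), h, height_succ, ← h]
    simp only [List.getD_eq_getElem?_getD]
    rw [← neg_sub (l[l.length - 1 - i]?.getD 0 : ℤ), Int.sign_neg]
    ring

theorem nonnegPath_drop (l : List ℕ) {n : ℕ} (hn : l.length = n) (k : ℕ) :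
    NonnegPath (l.drop k) ↔ ∀ i < n, k ≤ i → height l k ≤ height l i := by
  simp only [NonnegPath, List.length_drop, height_drop, hn]
  constructor
  · intro h i hi hki
    have := h (i - k) (by omega)
    rw [Nat.add_sub_cancel' hki] at this
    omega
  · intro h i hi
    have := h (k + i) (by omega) (by omega)
    omega

theorem nonnegPath_reverse_take (l : List ℕ) {k : ℕ} (hk : k ≤ l.length) :
    NonnegPath (l.take k).reverse ↔ ∀ i < k, height l (k - 1) ≤ height l i := by
  have hlen : (l.take k).length = k := by simp [hk]
  have key : ∀ i < k, height (l.take k).reverse i = height l (k - 1 - i) - height l (k - 1) := by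
    intro i hi
    rw [height_reverse _ (by omega), hlen, height_take _ (by omega), height_take _ (by omega)]
  simp only [NonnegPath, List.length_reverse, hlen]
  constructor
  · intro h i hi
    have := h (k - 1 - i) (by omega)
    rw [key _ (by omega), show k - 1 - (k - 1 - i) = i by omega] at this
    omega
  · intro h i hi
    rw [key i hi]
    have := h (k - 1 - i) (by omega)
    omega

theorem height_emod_two {l : List ℕ} (hl : l.Nodup) {i : ℕ} (hi : i < l.length) :
    height l i % 2 = i % 2 := by
  induction i with
  | zero => rfl
  | succ i ih =>
    have := ih (by omega)
    have := height_succ_of_nodup hl hi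
    push_cast
    omega

/-- A nonnegative path of odd length can be extended by any step. -/
theorem nonnegPath_take_iff {l : List ℕ} (hl : l.Nodup) {m : ℕ} (hm : l.length = 2 * m + 1) :
    NonnegPath (l.take (2 * m)) ↔ NonnegPath l := by
  have hlen : (l.take (2 * m)).length = 2 * m := by simp [hm]
  simp only [NonnegPath, hlen, hm]
  constructor
  · intro h i hi
    rcases Nat.lt_or_ge i (2 * m) with him | him
    · rw [← height_take l him]
      exact h i him
    · obtain rfl : i = 2 * m := by omega
      rcases m with _ | m
      · simp [height_zero]
      · have h1 := h (2 * m + 1) (by omega)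
        rw [height_take l (by omega)] at h1
        have h2 := height_emod_two hl (i := 2 * m + 1) (by omega)
        have h3 := height_succ_of_nodup hl (i := 2 * m + 1) (by omega)
        rw [show 2 * m + 1 + 1 = 2 * (m + 1) by omega] at h3
        push_cast at h2
        omega
  · intro h i hi
    rw [height_take l hi]
    exact h i (by omega)

theorem height_map {f : ℕ → ℕ} {S : Finset ℕ} (hf : StrictMonoOn f S) {l : List ℕ}
    (hl : l.toFinset = S) {i : ℕ} (hi : i < l.length) : height (l.map f) i = height l i := by
  refine sum_congr rfl fun j hj ↦ ?_
  rw [mem_range] at hj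
  have hmem : ∀ a (ha : a < l.length), l[a] ∈ (S : Set ℕ) := fun a ha ↦ by
    rw [← hl]
    simp
  rw [List.getD_eq_getElem _ _ (by simp; omega), List.getD_eq_getElem _ _ (by simp; omega),
    List.getD_eq_getElem _ _ (by omega), List.getD_eq_getElem _ _ (by omega),
    List.getElem_map, List.getElem_map]
  have h1 := hmem j (by omega)
  have h2 := hmem (j + 1) (by omega)
  rcases lt_trichotomy l[j] l[j + 1] with h | h | h
  · have := hf h1 h2 h
    rw [Int.sign_eq_neg_one_of_neg (by omega), Int.sign_eq_neg_one_of_neg (by omega)]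
  · rw [h, sub_self, sub_self]
  · have := hf h2 h1 h
    rw [Int.sign_eq_one_of_pos (by omega), Int.sign_eq_one_of_pos (by omega)]

theorem nonnegPath_map {f : ℕ → ℕ} {S : Finset ℕ} (hf : StrictMonoOn f S) {l : List ℕ}
    (hl : l.toFinset = S) : NonnegPath (l.map f) ↔ NonnegPath l := by
  simp only [NonnegPath, List.length_map]
  exact forall₂_congr fun i hi ↦ by rw [height_map hf hl hi]

theorem toFinset_map (l : List ℕ) (f : ℕ → ℕ) : (l.map f).toFinset = l.toFinset.image f := by
  ext x
  simp

theorem map_eq_self {l : List ℕ} {f : ℕ → ℕ} (h : ∀ x ∈ l, f x = x) : l.map f = l :=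
  (List.map_congr_left h).trans l.map_id

theorem card_nonnegPath_image {f : ℕ → ℕ} {S : Finset ℕ} (hf : StrictMonoOn f S) :
    #{l ∈ orderings (S.image f) | NonnegPath l} = #{l ∈ orderings S | NonnegPath l} := by
  symm
  have hmap : ∀ l : List ℕ, l.toFinset = S → (l.map f).toFinset = S.image f := by
    rintro l rfl
    exact toFinset_map l f
  refine card_nbij' (List.map f) (List.map (Function.invFunOn f S)) ?_ ?_ ?_ ?_
  · intro l hl
    simp only [coe_filter, mem_orderings, Set.mem_ofPred_eq] at hl ⊢
    obtain ⟨⟨hnd, hS⟩, hp⟩ := hl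
    refine ⟨⟨hnd.map_on fun x hx y hy hxy ↦ hf.injOn ?_ ?_ hxy, hmap l hS⟩,
      (nonnegPath_map hf hS).2 hp⟩
    · simpa [← hS] using hx
    · simpa [← hS] using hy
  · intro l hl
    simp only [coe_filter, mem_orderings, Set.mem_ofPred_eq] at hl ⊢
    obtain ⟨⟨hnd, hS⟩, hp⟩ := hl
    have hsub : ∀ x ∈ l, x ∈ f '' S := fun x hx ↦ by
      rw [← List.mem_toFinset, hS] at hx
      simpa using hx
    have hback : (l.map (Function.invFunOn f S)).map f = l := by
      rw [List.map_map]
      exact map_eq_self fun x hx ↦ Function.invFunOn_eq (hsub x hx)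
    have hS' : (l.map (Function.invFunOn f S)).toFinset = S := by
      rw [toFinset_map, hS, image_image]
      refine (image_congr fun x hx ↦ ?_).trans image_id
      exact hf.injOn.leftInvOn_invFunOn hx
    refine ⟨⟨?_, hS'⟩, ?_⟩
    · rw [← hback] at hnd
      exact hnd.of_map
    · rwa [← nonnegPath_map hf hS', hback]
  · intro l hl
    simp only [coe_filter, mem_orderings, Set.mem_ofPred_eq] at hl
    rw [List.map_map]
    refine map_eq_self fun x hx ↦ hf.injOn.leftInvOn_invFunOn ?_
    simpa [← hl.1.2] using hx
  · intro l hl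
    simp only [coe_filter, mem_orderings, Set.mem_ofPred_eq] at hl
    rw [List.map_map]
    refine map_eq_self fun x hx ↦ Function.invFunOn_eq ?_
    rw [← List.mem_toFinset, hl.1.2] at hx
    simpa using hx

/-- The number of orderings of an `n`-element set that are nonnegative paths. -/
def nonnegCount (n : ℕ) : ℕ := #{l ∈ orderings (range n) | NonnegPath l}

theorem card_nonnegPath (S : Finset ℕ) :
    #{l ∈ orderings S | NonnegPath l} = nonnegCount #S := by
  have hfin : (Set.ofPred (· ∈ S)).Finite := S.finite_toSet
  have hcard : #hfin.toFinset = #S := by congr; ext; simp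
  have hmono := Nat.nth_strictMonoOn hfin
  have himg := Nat.image_nth_Iio_card hfin
  rw [hcard] at hmono himg
  rw [← coe_range] at hmono himg
  rw [nonnegCount, ← card_nonnegPath_image hmono]
  congr
  rw [← coe_inj, coe_image, himg]
  rfl

theorem card_nonnegPath_reverse (S : Finset ℕ) :
    #{l ∈ orderings S | NonnegPath l.reverse} = nonnegCount #S := by
  rw [← card_nonnegPath]
  refine card_nbij' List.reverse List.reverse ?_ ?_ ?_ ?_ <;> intro l <;>
    simp +contextual [mem_orderings]

theorem nonnegCount_odd (m : ℕ) :
    nonnegCount (2 * m + 1) = (2 * m + 1) * nonnegCount (2 * m) := by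
  have h := card_orderings_filter_take_drop (range (2 * m + 1)) (2 * m) NonnegPath
    (fun _ ↦ True) (by simp)
  have h1 : ∀ T ∈ (range (2 * m + 1)).powersetCard (2 * m),
      #{l ∈ orderings T | NonnegPath l} * #{l ∈ orderings (range (2 * m + 1) \ T) | True} =
        nonnegCount (2 * m) := by
    intro T hT
    rw [mem_powersetCard] at hT
    obtain ⟨x, hx⟩ : ∃ x, range (2 * m + 1) \ T = {x} := by
      rw [← card_eq_one, card_sdiff_of_subset hT.1, hT.2, card_range]
      omega
    rw [card_nonnegPath, hT.2, hx, filter_true]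
    have : #(orderings {x}) = 1 :=
      (congrArg Multiset.card (Multiset.lists_coe [x])).trans
        (List.length_permutations [x])
    rw [this, mul_one]
  rw [sum_congr rfl h1, sum_const, card_powersetCard, card_range, Nat.choose_succ_self_right,
    smul_eq_mul] at h
  rw [← h, nonnegCount]
  congr 1
  refine filter_congr fun l hl ↦ ?_
  rw [and_true, nonnegPath_take_iff (mem_orderings.1 hl).1]
  simpa using length_of_mem_orderings hl

theorem sum_neg_one_pow_nonnegCount {n : ℕ} (hn : 0 < n) :
    ∑ k ∈ range (n + 1), (-1 : ℤ) ^ k * (n.choose k * nonnegCount k * nonnegCount (n - k)) = 0 := by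
  have hcut : ∀ k ∈ range (n + 1), (n.choose k * nonnegCount k * nonnegCount (n - k) : ℤ) =
      #{w ∈ orderings (range n) | NonnegPath (w.take k).reverse ∧ NonnegPath (w.drop k)} := by
    intro k hk
    rw [mem_range] at hk
    rw [card_orderings_filter_take_drop (range n) k (fun l ↦ NonnegPath l.reverse) NonnegPath
      (by rw [card_range]; omega)]
    rw [sum_congr rfl (g := fun _ ↦ nonnegCount k * nonnegCount (n - k))]
    · simp [mul_assoc]
    · intro T hT
      rw [mem_powersetCard] at hT
      rw [card_nonnegPath_reverse, card_nonnegPath, card_sdiff_of_subset hT.1, hT.2, card_range]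
  rw [sum_congr rfl fun k hk ↦ by rw [hcut k hk]]
  simp_rw [card_filter, Nat.cast_sum, mul_sum]
  rw [sum_comm]
  refine sum_eq_zero fun w hw ↦ ?_
  have hlen : w.length = n := by simpa using length_of_mem_orderings hw
  rw [← sum_neg_one_pow_cuts hn (height w)
    fun i hi ↦ height_succ_of_nodup (mem_orderings.1 hw).1 (hlen ▸ hi), sum_filter]
  refine sum_congr rfl fun k hk ↦ ?_
  rw [mem_range] at hk
  simp only [nonnegPath_drop w hlen, nonnegPath_reverse_take w (show k ≤ w.length by omega)]
  split_ifs <;> simp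

end Orderings

section GeneratingFunction

open PowerSeries Finset

/-- The formal identities `A(X) A(-X) = 1` and `(1 - X) A(X) = (1 + X) A(-X)` imply
`(1 - X²) A' = A`. -/
theorem derivative_eq_of_mul_eq {A B : ℚ⟦X⟧} (h1 : A * B = 1)
    (h2 : (1 - X) * A = (1 + X) * B) : (1 - X ^ 2) * derivative ℚ A = A := by
  have hsq : (1 - X) * A ^ 2 = 1 + X := by linear_combination A * h2 + (1 + X) * h1
  have hd := congrArg (derivative ℚ) hsq
  simp only [Derivation.leibniz, derivative_pow, map_sub, map_add, derivative_one, derivative_X,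
    smul_eq_mul] at hd
  have hkey : C (2 : ℚ) * ((1 - X) ^ 2 * A * derivative ℚ A) = C 2 * 1 := by
    simp only [Nat.cast_ofNat, map_ofNat] at hd ⊢
    linear_combination (1 - X) * hd + hsq
  have hkey' := mul_left_cancel₀ (by simp) hkey
  linear_combination A * hkey' - (1 - X) * derivative ℚ A * hsq

theorem recurrence_of_alternating_convolution (a : ℕ → ℕ) (h0 : a 0 = 1)
    (hodd : ∀ m, a (2 * m + 1) = (2 * m + 1) * a (2 * m))
    (hsum : ∀ n, 0 < n →
      ∑ k ∈ range (n + 1), (-1 : ℤ) ^ k * (n.choose k * a k * a (n - k)) = 0) (n : ℕ) :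
    a (n + 2) = a (n + 1) + (n + 1) * n * a n := by
  set A : ℚ⟦X⟧ := mk fun n ↦ (a n : ℚ) / n.factorial with hA
  set B : ℚ⟦X⟧ := mk fun n ↦ (-1) ^ n * ((a n : ℚ) / n.factorial) with hB
  have h1 : A * B = 1 := by
    rw [mul_comm]
    ext n
    rw [coeff_mul, coeff_one, Nat.sum_antidiagonal_eq_sum_range_succ
      (fun i j ↦ coeff i B * coeff j A)]
    simp only [hA, hB, coeff_mk]
    split_ifs with hn
    · subst hn
      simp [h0]
    · have h := congrArg (fun z : ℤ ↦ (z : ℚ) / n.factorial) (hsum n (Nat.pos_of_ne_zero hn))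
      simp only [Int.cast_zero, zero_div] at h
      rw [← h]
      push_cast
      rw [sum_div]
      refine sum_congr rfl fun k hk ↦ ?_
      rw [Nat.cast_choose ℚ (by rw [mem_range] at hk; omega)]
      have := n.factorial_ne_zero
      have := k.factorial_ne_zero
      have := (n - k).factorial_ne_zero
      field_simp
  have h2 : (1 - X) * A = (1 + X) * B := by
    ext n
    rw [sub_mul, add_mul, one_mul, one_mul, map_sub, map_add]
    rcases n with _ | n
    · simp [hA, hB]
    rw [coeff_succ_X_mul, coeff_succ_X_mul]
    simp only [hA, hB, coeff_mk]
    rcases Nat.even_or_odd' n with ⟨m, rfl | rfl⟩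
    · rw [hodd, Nat.factorial_succ, pow_succ, pow_mul]
      have := (2 * m).factorial_ne_zero
      push_cast
      field_simp
      ring
    · rw [pow_succ, pow_succ, pow_mul]
      simp
      ring
  have h3 := congrArg (coeff (n + 1)) (derivative_eq_of_mul_eq h1 h2)
  rw [sub_mul, one_mul, map_sub, coeff_derivative] at h3
  have h4 : coeff (n + 1) (X ^ 2 * derivative ℚ A) = n * coeff n A := by
    rcases n with _ | n
    · simp [pow_two, mul_assoc]
    · rw [show n + 1 + 1 = n + 2 by rfl, coeff_X_pow_mul, coeff_derivative]
      push_cast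
      ring
  rw [h4] at h3
  simp only [hA, coeff_mk, Nat.factorial_succ] at h3
  have := n.factorial_ne_zero
  push_cast at h3
  field_simp at h3
  have h5 : (a (n + 2) : ℚ) = a (n + 1) + (n + 1) * n * a n := by linear_combination h3
  exact_mod_cast h5

open Nat in
theorem eq_doubleFactorial_of_recurrence (a : ℕ → ℕ) (h0 : a 0 = 1)
    (hodd : ∀ m, a (2 * m + 1) = (2 * m + 1) * a (2 * m))
    (hrec : ∀ n, a (n + 2) = a (n + 1) + (n + 1) * n * a n) (n : ℕ) :
    a n = if Even n then (n - 1)‼ ^ 2 else n‼ * (n - 2)‼ := by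
  have heven : ∀ m, a (2 * m) = (2 * m - 1)‼ ^ 2 := by
    intro m
    induction m with
    | zero => simp [h0]
    | succ m ih =>
      rw [show 2 * (m + 1) = 2 * m + 2 by ring, hrec, hodd, ih,
        show 2 * m + 2 - 1 = 2 * m + 1 by omega, doubleFactorial_add_one]
      ring
  rcases Nat.even_or_odd' n with ⟨m, rfl | rfl⟩
  · rw [if_pos (even_two_mul m), heven]
  · rw [if_neg (by simp), hodd, heven, show 2 * m + 1 - 2 = 2 * m - 1 by omega,
      doubleFactorial_add_one]
    ring

end GeneratingFunction

section Perm

open Finset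

theorem height_ofFn_perm {n : ℕ} (σ : Equiv.Perm (Fin n)) {i : ℕ} (hi : i < n) :
    height (List.ofFn fun x ↦ (σ x : ℕ)) i =
      descentsBelow n σ (i + 1) - ascentsBelow n σ (i + 1) := by
  set l := List.ofFn fun x ↦ (σ x : ℕ) with hl
  have hget : ∀ (j : ℕ) (hj : j < n), l.getD j 0 = σ ⟨j, hj⟩ := fun j hj ↦ by
    rw [List.getD_eq_getElem _ _ (by simpa [hl] using hj)]
    simp [hl]
  have hrange : range i = {j ∈ range (n - 1) | j + 1 < i + 1} := by
    ext j
    simp only [mem_range, mem_filter]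
    omega
  rw [height, hrange, sum_filter, ← Fin.sum_univ_eq_sum_range
    (fun j ↦ if j + 1 < i + 1 then ((l.getD j 0 : ℤ) - l.getD (j + 1) 0).sign else 0),
    descentsBelow, ascentsBelow, card_filter, card_filter, Nat.cast_sum, Nat.cast_sum,
    ← sum_sub_distrib]
  refine sum_congr rfl fun x _ ↦ ?_
  have hx := x.isLt
  rw [hget x (by omega), hget (x + 1) (by omega)]
  by_cases h : (x : ℕ) + 1 < i + 1
  · simp only [h, true_and, if_true, Fin.lt_def]
    generalize (σ ⟨x, _⟩ : ℕ) = p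
    generalize (σ ⟨x + 1, _⟩ : ℕ) = q
    rcases lt_trichotomy p q with h | rfl | h
    · rw [Int.sign_eq_neg_one_of_neg (by omega), if_neg (by omega), if_pos h]
      rfl
    · simp
    · rw [Int.sign_eq_one_of_pos (by omega), if_pos h, if_neg (by omega)]
      rfl
  · simp only [h, false_and, if_false]
    rfl

theorem ascentsBelow_le_descentsBelow_iff {n : ℕ} (σ : Equiv.Perm (Fin n)) :
    (∀ j ≤ n, ascentsBelow n σ j ≤ descentsBelow n σ j) ↔
      NonnegPath (List.ofFn fun x ↦ (σ x : ℕ)) := by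
  rw [NonnegPath, List.length_ofFn]
  constructor
  · intro h i hi
    have := h (i + 1) hi
    rw [height_ofFn_perm σ hi]
    omega
  · rintro h (_ | j) hj
    · simp [ascentsBelow]
    · have := h j hj
      rw [height_ofFn_perm σ hj] at this
      omega

theorem card_perm_nonnegPath (n : ℕ) :
    Nat.card {σ : Equiv.Perm (Fin n) // NonnegPath (List.ofFn fun x ↦ (σ x : ℕ))} =
      nonnegCount n := by
  rw [Nat.card_eq_fintype_card, Fintype.card_subtype, nonnegCount]
  refine card_bij (fun σ _ ↦ List.ofFn fun x ↦ (σ x : ℕ)) ?_ ?_ ?_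
  · intro σ hσ
    rw [mem_filter] at hσ ⊢
    refine ⟨mem_orderings.2 ⟨List.nodup_ofFn.2 (Fin.val_injective.comp σ.injective), ?_⟩, hσ.2⟩
    ext y
    simp only [List.mem_toFinset, List.mem_ofFn, mem_range]
    constructor
    · rintro ⟨x, rfl⟩
      exact (σ x).isLt
    · intro hy
      exact ⟨σ.symm ⟨y, hy⟩, by simp⟩
  · intro σ _ τ _ h
    ext x
    exact congrFun (List.ofFn_injective h) x
  · intro l hl
    rw [mem_filter] at hl
    have hlen : l.length = n := by simpa using length_of_mem_orderings hl.1
    obtain ⟨hnd, hS⟩ := mem_orderings.1 hl.1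
    have hlt : ∀ x : Fin n, l[x] < n := fun x ↦ by
      rw [← mem_range, ← hS]
      simp
    have hinj : Function.Injective fun x : Fin n ↦ (⟨l[x], hlt x⟩ : Fin n) := by
      intro x y hxy
      simp only [Fin.mk.injEq] at hxy
      exact Fin.ext (hnd.getElem_inj_iff.1 hxy)
    have hofFn : (List.ofFn fun x : Fin n ↦ l[x]) = l := by
      subst hlen
      exact List.ofFn_getElem
    refine ⟨Equiv.ofBijective _ (Finite.injective_iff_bijective.1 hinj), ?_, hofFn⟩
    rw [mem_filter]
    refine ⟨mem_univ _, ?_⟩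
    exact hofFn.symm ▸ hl.2

end Perm

theorem nonnegCount_zero : nonnegCount 0 = 1 := by
  rw [nonnegCount, Finset.card_eq_one]
  refine ⟨[], ?_⟩
  ext l
  simp only [Finset.mem_filter, mem_orderings, Finset.range_zero, List.toFinset_eq_empty_iff,
    Finset.mem_singleton]
  constructor
  · exact fun h ↦ h.1.2
  · rintro rfl
    simp [NonnegPath]

/-- The number of permutations of `{1,…,n}` such that every prefix has no more ascents
than descents is `[(n-1)!!]²` if `n` is even and `n!!·(n-2)!!` if `n` is odd. -/
theorem count_positive_updown (n : ℕ) :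
    Nat.card {σ : Equiv.Perm (Fin n) //
        ∀ j ≤ n, ascentsBelow n σ j ≤ descentsBelow n σ j} =
      if Even n then Nat.doubleFactorial (n - 1) ^ 2
      else Nat.doubleFactorial n * Nat.doubleFactorial (n - 2) := by
  simp_rw [ascentsBelow_le_descentsBelow_iff]
  rw [card_perm_nonnegPath]
  exact eq_doubleFactorial_of_recurrence nonnegCount nonnegCount_zero nonnegCount_odd
    (recurrence_of_alternating_convolution nonnegCount nonnegCount_zero nonnegCount_odd
      fun _ ↦ sum_neg_one_pow_nonnegCount) n
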